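/- Let z ≠ 0 be real and, on the open subset of ℝ² where q_1 ≠ 0 and q_2 ≠ 0, consider the diagonal metric with g_{11}(q_1,q_2) = (2 z q_1²/sinh(z q_1²)) e^{−z q_1²} e^{−2 z q_2²} and g_{22}(q_1,q_2) = (2 z q_2²/sinh(z q_2²)) e^{−z q_2²}. Then its Gaussian curvature is constant and equal to the deformation parameter: K(q_1,q_2) = z at every point of this open set. -/

import Mathlib

open Real

noncomputable section

/-- Partial derivative in the first coordinate of a function on ℝ². -/
noncomputable def pd1 (f : ℝ × ℝ → ℝ) (x : ℝ × ℝ) : ℝ :=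
  deriv (fun t => f (t, x.2)) x.1

/-- Partial derivative in the second coordinate of a function on ℝ². -/
noncomputable def pd2 (f : ℝ × ℝ → ℝ) (x : ℝ × ℝ) : ℝ :=
  deriv (fun t => f (x.1, t)) x.2

/-- Gaussian curvature of the diagonal metric `ds² = g₁₁ dq₁² + g₂₂ dq₂²`:
`K = −(1/√(g₁₁g₂₂)) [ ∂₁((1/√g₁₁) ∂₁√g₂₂) + ∂₂((1/√g₂₂) ∂₂√g₁₁) ]`. -/
noncomputable def gaussK (g11 g22 : ℝ × ℝ → ℝ) (x : ℝ × ℝ) : ℝ :=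
  -(1 / Real.sqrt (g11 x * g22 x)) *
    (pd1 (fun y => 1 / Real.sqrt (g11 y) * pd1 (fun w => Real.sqrt (g22 w)) y) x
      + pd2 (fun y => 1 / Real.sqrt (g22 y) * pd2 (fun w => Real.sqrt (g11 w)) y) x)

/-- The factor `2zt²/sinh(zt²) e^{−zt²}` without hyperbolic functions. -/
lemma div_sinh_mul_exp_neg (z t : ℝ) :
    2 * z * t ^ 2 / Real.sinh (z * t ^ 2) * Real.exp (-(z * t ^ 2))
      = 4 * z * t ^ 2 / (Real.exp (2 * z * t ^ 2) - 1) := by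
  have hE : Real.exp (2 * z * t ^ 2) = Real.exp (z * t ^ 2) ^ 2 := by
    rw [← Real.exp_nat_mul]; ring_nf
  rw [hE, Real.sinh_eq, Real.exp_neg]
  have hp := Real.exp_pos (z * t ^ 2)
  generalize Real.exp (z * t ^ 2) = E at *
  have hs : (E - E⁻¹) / 2 = (E ^ 2 - 1) / (2 * E) := by field_simp
  rw [hs]
  by_cases hD : E ^ 2 - 1 = 0
  · simp [hD]
  · field_simp
    ring

lemma four_mul_sq_div_exp_sub_one_pos {z t : ℝ} (hz : z ≠ 0) (ht : t ≠ 0) :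
    0 < 4 * z * t ^ 2 / (Real.exp (2 * z * t ^ 2) - 1) := by
  have ht2 : 0 < t ^ 2 := by positivity
  rcases lt_or_gt_of_ne hz with h | h
  · refine div_pos_of_neg_of_neg (by nlinarith) ?_
    have := Real.exp_lt_one_iff.2 (show 2 * z * t ^ 2 < 0 by nlinarith)
    linarith
  · refine div_pos (by positivity) ?_
    have := Real.one_lt_exp_iff.2 (show 0 < 2 * z * t ^ 2 by positivity)
    linarith

lemma hasDerivAt_mul_exp_div_sqrt {z t : ℝ} (hz : z ≠ 0) (ht : t ≠ 0) :
    HasDerivAt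
      (fun s => s * Real.exp (-(z * s ^ 2))
        / Real.sqrt (4 * z * s ^ 2 / (Real.exp (2 * z * s ^ 2) - 1)))
      (Real.exp (-(z * t ^ 2))
        * Real.sqrt (4 * z * t ^ 2 / (Real.exp (2 * z * t ^ 2) - 1)) / 2) t := by
  have hpos := four_mul_sq_div_exp_sub_one_pos hz ht
  have hD : Real.exp (2 * z * t ^ 2) - 1 ≠ 0 := by
    intro h
    simp [h] at hpos
  have hsq : HasDerivAt (fun s : ℝ => s ^ 2) (2 * t) t := by
    simpa using hasDerivAt_pow 2 t
  have hden := ((hsq.const_mul (2 * z)).exp).sub_const 1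
  have hquot := (hsq.const_mul (4 * z)).fun_div hden hD
  have hnum := (hasDerivAt_id' t).fun_mul (hsq.const_mul z).fun_neg.exp
  have hroot := Real.sqrt_pos.2 hpos
  refine (hnum.fun_div (hquot.sqrt hpos.ne') hroot.ne').congr_deriv ?_
  have hR := Real.sq_sqrt hpos.le
  generalize Real.sqrt (4 * z * t ^ 2 / (Real.exp (2 * z * t ^ 2) - 1)) = R at *
  generalize Real.exp (2 * z * t ^ 2) = F at *
  generalize Real.exp (-(z * t ^ 2)) = e at *
  have hRF : R ^ 2 * (F - 1) = 4 * z * t ^ 2 := by rw [hR]; field_simp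
  have hR0 : R ≠ 0 := hroot.ne'
  field_simp
  linear_combination e * ((2 - 4 * z * t ^ 2) * (F - 1) - (R ^ 2 * (F - 1) + 4 * z * t ^ 2)) * hRF

/-- the metric `g₁₁ = (2zq₁²/sinh(zq₁²)) e^{−zq₁²} e^{−2zq₂²}`,
`g₂₂ = (2zq₂²/sinh(zq₂²)) e^{−zq₂²}` has constant Gaussian curvature equal to
the deformation parameter: `K = z` wherever `q₁ ≠ 0` and `q₂ ≠ 0`. -/
theorem curvature_MS_case (z : ℝ) (hz : z ≠ 0)
    (x : ℝ × ℝ) (h1 : x.1 ≠ 0) (h2 : x.2 ≠ 0) :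
    gaussK
      (fun y => 2 * z * y.1 ^ 2 / Real.sinh (z * y.1 ^ 2)
        * Real.exp (-(z * y.1 ^ 2)) * Real.exp (-(2 * z * y.2 ^ 2)))
      (fun y => 2 * z * y.2 ^ 2 / Real.sinh (z * y.2 ^ 2) * Real.exp (-(z * y.2 ^ 2)))
      x
      = z := by
  simp only [gaussK, pd1, pd2, div_sinh_mul_exp_neg, deriv_const, mul_zero, zero_add]
  obtain ⟨p, q⟩ := x
  simp only at h1 h2 ⊢
  have hp := four_mul_sq_div_exp_sub_one_pos hz h1
  have hq := four_mul_sq_div_exp_sub_one_pos hz h2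
  generalize 4 * z * p ^ 2 / (Real.exp (2 * z * p ^ 2) - 1) = a at *
  have hexp : ∀ s : ℝ, Real.sqrt (a * Real.exp (-(2 * z * s ^ 2)))
      = Real.sqrt a * Real.exp (-(z * s ^ 2)) := by
    intro s
    have : Real.exp (-(2 * z * s ^ 2)) = Real.exp (-(z * s ^ 2)) ^ 2 := by
      rw [← Real.exp_nat_mul]; ring_nf
    rw [Real.sqrt_mul hp.le, this, Real.sqrt_sq (Real.exp_pos _).le]
  have hinner : ∀ s : ℝ, deriv (fun t => Real.sqrt a * Real.exp (-(z * t ^ 2))) s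
      = -(2 * z * Real.sqrt a) * (s * Real.exp (-(z * s ^ 2))) := by
    intro s
    have hsq : HasDerivAt (fun r : ℝ => r ^ 2) (2 * s) s := by
      simpa using hasDerivAt_pow 2 s
    rw [((hsq.const_mul z).fun_neg.exp.const_mul (Real.sqrt a)).deriv]
    ring
  have houter := ((hasDerivAt_mul_exp_div_sqrt hz h2).const_mul
    (-(2 * z * Real.sqrt a))).deriv
  have hcomm : ∀ s b : ℝ, 1 / b * (-(2 * z * Real.sqrt a) * (s * Real.exp (-(z * s ^ 2))))
      = -(2 * z * Real.sqrt a) * (s * Real.exp (-(z * s ^ 2)) / b) := by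
    intro s b
    ring
  simp only [hexp, hinner, hcomm]
  rw [houter, Real.sqrt_mul (by positivity), hexp]
  have ha := Real.sqrt_pos.2 hp
  have hb := Real.sqrt_pos.2 hq
  have he := Real.exp_pos (-(z * q ^ 2))
  generalize Real.sqrt (4 * z * q ^ 2 / (Real.exp (2 * z * q ^ 2) - 1)) = b at *
  field_simp
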